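/- arXiv:2202.02388 — 10 statements merged into one kernel-verified Lean document; each statement's English description precedes it below -/
import Mathlib

section
/- Let h, f : ℝⁿ → ℝ be differentiable, with h μ_h-strongly convex with L_h-Lipschitz gradient and f μ_f-strongly convex with L_f-Lipschitz gradient (0 < μ_h ≤ L_h, 0 < μ_f ≤ L_f). Let ψ : ℝⁿ → ℝⁿ be the inverse of ∇h, let D : ℝⁿ → ℝⁿ be M-Lipschitz with M > 0, and let γ > 0. Then the PnP-BPGM map T = D ∘ ψ ∘ (∇h − γ∇f) is Lipschitz continuous with constant (M/μ_h)·max(L_h − γμ_f, γL_f − μ_h). -/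
open scoped InnerProductSpace

section GradientBounds

variable {E : Type*} [NormedAddCommGroup E] [InnerProductSpace ℝ E]

/-- A field `G` whose first-order model of `g` has error at most `C / 2 * ‖e‖ ^ 2` is
`C`-Lipschitz. -/
theorem lipschitz_of_quadratic_model {g : E → ℝ} {G : E → E} {C : ℝ}
    (hC : 0 ≤ C) (hmodel : ∀ x e, |g (x + e) - g x - ⟪G x, e⟫_ℝ| ≤ C / 2 * ‖e‖ ^ 2) (x y : E) :
    ‖G x - G y‖ ≤ C * ‖x - y‖ := by
  rcases eq_or_ne x y with rfl | hxy
  · simp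
  rcases eq_or_ne (G x) (G y) with hG | hG
  · rw [hG, sub_self, norm_zero]
    positivity
  have hd : 0 < ‖G x - G y‖ := norm_pos_iff.2 (sub_ne_zero.2 hG)
  have he : 0 < ‖x - y‖ := norm_pos_iff.2 (sub_ne_zero.2 hxy)
  set a : E := (1 / 2 : ℝ) • (x - y) with ha
  set v : E := (‖x - y‖ / (2 * ‖G x - G y‖)) • (G x - G y) with hv
  have hna : ‖a‖ = ‖x - y‖ / 2 := by
    rw [ha, norm_smul]
    norm_num
    ring
  have hnv : ‖v‖ = ‖x - y‖ / 2 := by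
    rw [hv, norm_smul, Real.norm_eq_abs, abs_of_nonneg (by positivity)]
    field_simp
  have hinner : ⟪G x, v⟫_ℝ - ⟪G y, v⟫_ℝ = ‖x - y‖ * ‖G x - G y‖ / 2 := by
    rw [← inner_sub_left, hv, inner_smul_right, real_inner_self_eq_norm_sq]
    field_simp
  have hpar := parallelogram_law_with_norm ℝ a v
  rw [hna, hnv] at hpar
  have hy : y = x - (2 : ℝ) • a := by
    rw [ha, smul_smul]
    norm_num
  have h₁ := (abs_le.1 (hmodel x (-a - v))).2
  have h₂ := (abs_le.1 (hmodel y (a - v))).1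
  have h₃ := (abs_le.1 (hmodel y (a + v))).2
  have h₄ := (abs_le.1 (hmodel x (-a + v))).1
  have hm₁ : y + (a - v) = x + (-a - v) := by
    rw [hy]
    module
  have hm₂ : y + (a + v) = x + (-a + v) := by
    rw [hy]
    module
  have hn₁ : ‖-a - v‖ = ‖a + v‖ := by rw [← norm_neg, neg_sub, sub_neg_eq_add, add_comm]
  have hn₂ : ‖-a + v‖ = ‖a - v‖ := by rw [← norm_neg, neg_add, neg_neg, sub_eq_add_neg]
  rw [hm₁] at h₂
  rw [hm₂] at h₃
  rw [hn₁] at h₁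
  rw [hn₂] at h₄
  simp only [inner_sub_right, inner_add_right, inner_neg_right] at h₁ h₂ h₃ h₄
  have hmul : ‖G x - G y‖ * ‖x - y‖ ≤ C * ‖x - y‖ * ‖x - y‖ := by nlinarith
  exact le_of_mul_le_mul_right hmul he

variable [CompleteSpace E]

theorem hasDerivAt_comp_line {f : E → ℝ} (hf : Differentiable ℝ f) (x e : E) (t : ℝ) :
    HasDerivAt (fun s : ℝ => f (x + s • e)) ⟪gradient f (x + t • e), e⟫_ℝ t := by
  have hline : HasDerivAt (fun s : ℝ => x + s • e) e t := by
    simpa using ((hasDerivAt_id t).smul_const e).const_add x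
  have hgrad := (hf (x + t • e)).hasGradientAt.hasFDerivAt
  exact (hgrad.comp_hasDerivAt t hline).congr_deriv (by simp)

/-- First-order lower bound for a strongly convex function. -/
theorem strongly_convex_lower_bound {f : E → ℝ} {μ : ℝ} (hf : Differentiable ℝ f)
    (hsc : ConvexOn ℝ Set.univ (fun x => f x - μ / 2 * ‖x‖ ^ 2)) (x e : E) :
    f x + ⟪gradient f x, e⟫_ℝ + μ / 2 * ‖e‖ ^ 2 ≤ f (x + e) := by
  have hconv : ConvexOn ℝ Set.univ
      (fun s : ℝ => f (x + s • e) - μ / 2 * ‖x + s • e‖ ^ 2) := by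
    have hcomp := hsc.comp_affineMap (AffineMap.lineMap x (x + e) : ℝ →ᵃ[ℝ] E)
    simpa [Function.comp_def, AffineMap.lineMap_apply, add_comm] using hcomp
  have hnorm (s : ℝ) :
      ‖x + s • e‖ ^ 2 = ‖x‖ ^ 2 + 2 * (s * ⟪x, e⟫_ℝ) + s ^ 2 * ‖e‖ ^ 2 := by
    rw [norm_add_sq_real, inner_smul_right, norm_smul, mul_pow, Real.norm_eq_abs, sq_abs]
  simp only [hnorm] at hconv
  have hquad : HasDerivAt
      (fun s : ℝ => μ / 2 * (‖x‖ ^ 2 + 2 * (s * ⟪x, e⟫_ℝ) + s ^ 2 * ‖e‖ ^ 2))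
      (μ * ⟪x, e⟫_ℝ) 0 := by
    have hlin := (((hasDerivAt_id (0 : ℝ)).mul_const ⟪x, e⟫_ℝ).const_mul 2).const_add (‖x‖ ^ 2)
    have hsq := ((hasDerivAt_id (0 : ℝ)).pow 2).mul_const (‖e‖ ^ 2)
    refine ((hlin.add hsq).const_mul (μ / 2)).congr_deriv ?_
    simp
    ring
  have hderiv := (hasDerivAt_comp_line hf x e 0).sub hquad
  have hslope := hconv.le_slope_of_hasDerivAt (Set.mem_univ 0) (Set.mem_univ 1)
    one_pos hderiv
  simp only [slope_def_field, zero_smul, one_smul, add_zero] at hslope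
  linarith

/-- The descent lemma. -/
theorem descent_upper_bound {f : E → ℝ} {L : ℝ} (hf : Differentiable ℝ f)
    (hlip : ∀ x y, ‖gradient f x - gradient f y‖ ≤ L * ‖x - y‖) (x e : E) :
    f (x + e) ≤ f x + ⟪gradient f x, e⟫_ℝ + L / 2 * ‖e‖ ^ 2 := by
  have hderiv (t : ℝ) : HasDerivAt
      (fun s : ℝ => f (x + s • e) - (s * ⟪gradient f x, e⟫_ℝ + s ^ 2 * (L / 2 * ‖e‖ ^ 2)))
      (⟪gradient f (x + t • e), e⟫_ℝ - (⟪gradient f x, e⟫_ℝ + t * (L * ‖e‖ ^ 2))) t := by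
    have hlin := (hasDerivAt_id t).mul_const ⟪gradient f x, e⟫_ℝ
    have hsq := ((hasDerivAt_id t).pow 2).mul_const (L / 2 * ‖e‖ ^ 2)
    refine ((hasDerivAt_comp_line hf x e t).sub (hlin.add hsq)).congr_deriv ?_
    simp
    ring
  have hanti := antitoneOn_of_deriv_nonpos (convex_Icc (0 : ℝ) 1)
    (fun t _ => (hderiv t).continuousAt.continuousWithinAt)
    (fun t _ => (hderiv t).differentiableAt.differentiableWithinAt)
    (fun t ht => by
      rw [interior_Icc] at ht
      rw [(hderiv t).deriv]
      have hcs := real_inner_le_norm (gradient f (x + t • e) - gradient f x) e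
      have hl := hlip (x + t • e) x
      rw [add_sub_cancel_left, norm_smul, Real.norm_eq_abs, abs_of_pos ht.1] at hl
      have hmul := mul_le_mul_of_nonneg_right hl (norm_nonneg e)
      rw [inner_sub_left] at hcs
      linarith)
  have hle := hanti (Set.left_mem_Icc.2 zero_le_one) (Set.right_mem_Icc.2 zero_le_one) zero_le_one
  simp only [zero_smul, one_smul, add_zero] at hle
  linarith

/-- The gradient of a `μ`-strongly convex function is `μ`-expansive. -/
theorem strongly_convex_gradient_expansive {f : E → ℝ} {μ : ℝ} (hf : Differentiable ℝ f)
    (hsc : ConvexOn ℝ Set.univ (fun x => f x - μ / 2 * ‖x‖ ^ 2)) (x y : E) :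
    μ * ‖x - y‖ ≤ ‖gradient f x - gradient f y‖ := by
  rcases eq_or_ne x y with rfl | hxy
  · simp
  have he : 0 < ‖x - y‖ := norm_pos_iff.2 (sub_ne_zero.2 hxy)
  have h₁ := strongly_convex_lower_bound hf hsc x (-(x - y))
  have h₂ := strongly_convex_lower_bound hf hsc y (x - y)
  have hcs := real_inner_le_norm (gradient f x - gradient f y) (x - y)
  rw [inner_neg_right, norm_neg, neg_sub, add_sub_cancel] at h₁
  rw [add_sub_cancel] at h₂
  rw [inner_sub_left] at hcs
  exact le_of_mul_le_mul_right (by linarith) he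

/-- Lipschitz bound for a difference of gradients of smooth strongly convex functions. -/
theorem gradient_sub_smul_gradient_lipschitz {h f : E → ℝ} {μh Lh μf Lf γ : ℝ}
    (hh : Differentiable ℝ h) (hf : Differentiable ℝ f) (hLh : μh ≤ Lh) (hLf : μf ≤ Lf)
    (hsc_h : ConvexOn ℝ Set.univ (fun x => h x - μh / 2 * ‖x‖ ^ 2))
    (hlip_h : ∀ x y, ‖gradient h x - gradient h y‖ ≤ Lh * ‖x - y‖)
    (hsc_f : ConvexOn ℝ Set.univ (fun x => f x - μf / 2 * ‖x‖ ^ 2))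
    (hlip_f : ∀ x y, ‖gradient f x - gradient f y‖ ≤ Lf * ‖x - y‖) (hγ : 0 ≤ γ) (x y : E) :
    ‖(gradient h x - γ • gradient f x) - (gradient h y - γ • gradient f y)‖ ≤
      max (Lh - γ * μf) (γ * Lf - μh) * ‖x - y‖ := by
  have hC₁ := le_max_left (Lh - γ * μf) (γ * Lf - μh)
  have hC₂ := le_max_right (Lh - γ * μf) (γ * Lf - μh)
  set C := max (Lh - γ * μf) (γ * Lf - μh)
  have hC : 0 ≤ C := by
    have := mul_le_mul_of_nonneg_left hLf hγ
    linarith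
  refine lipschitz_of_quadratic_model (g := fun x => h x - γ * f x)
    (G := fun x => gradient h x - γ • gradient f x) hC (fun x e => ?_) x y
  have hlow := strongly_convex_lower_bound hh hsc_h x e
  have hup := descent_upper_bound hh hlip_h x e
  have flow := mul_le_mul_of_nonneg_left (strongly_convex_lower_bound hf hsc_f x e) hγ
  have fup := mul_le_mul_of_nonneg_left (descent_upper_bound hf hlip_f x e) hγ
  have hsq₁ := mul_le_mul_of_nonneg_right hC₁ (sq_nonneg ‖e‖)
  have hsq₂ := mul_le_mul_of_nonneg_right hC₂ (sq_nonneg ‖e‖)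
  rw [inner_sub_left, real_inner_smul_left, abs_le]
  constructor <;> linarith

end GradientBounds

/-- **Lipschitz constant of the PnP-BPGM map.** Under strong convexity and Lipschitz-gradient
assumptions on `h` and `f`, with `D` an `M`-Lipschitz operator, the PnP-BPGM map
`T = D ∘ ψ ∘ (∇h − γ∇f)` is Lipschitz with constant `(M/μh) · max(Lh − γμf, γLf − μh)`. -/
theorem pnp_bpgm_map_lipschitz {n : ℕ}
    (h f : EuclideanSpace ℝ (Fin n) → ℝ)
    (μh Lh μf Lf M γ : ℝ)
    (hh : Differentiable ℝ h) (hf : Differentiable ℝ f)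
    (hμh : 0 < μh) (hLh : μh ≤ Lh) (hμf : 0 < μf) (hLf : μf ≤ Lf)
    (hsc_h : ConvexOn ℝ Set.univ (fun x => h x - μh / 2 * ‖x‖ ^ 2))
    (hlip_h : ∀ x y, ‖gradient h x - gradient h y‖ ≤ Lh * ‖x - y‖)
    (hsc_f : ConvexOn ℝ Set.univ (fun x => f x - μf / 2 * ‖x‖ ^ 2))
    (hlip_f : ∀ x y, ‖gradient f x - gradient f y‖ ≤ Lf * ‖x - y‖)
    (ψ D : EuclideanSpace ℝ (Fin n) → EuclideanSpace ℝ (Fin n))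
    (hψ₁ : ∀ x, ψ (gradient h x) = x)
    (hψ₂ : ∀ y, gradient h (ψ y) = y)
    (hM : 0 < M)
    (hlipD : ∀ x y, ‖D x - D y‖ ≤ M * ‖x - y‖)
    (hγ : 0 < γ)
    (T : EuclideanSpace ℝ (Fin n) → EuclideanSpace ℝ (Fin n))
    (hT : T = fun x => D (ψ (gradient h x - γ • gradient f x))) :
    ∀ x y : EuclideanSpace ℝ (Fin n),
      ‖T x - T y‖ ≤ M / μh * max (Lh - γ * μf) (γ * Lf - μh) * ‖x - y‖ := by
  intro x y
  subst hT
  have hexp := strongly_convex_gradient_expansive hh hsc_h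
    (ψ (gradient h x - γ • gradient f x)) (ψ (gradient h y - γ • gradient f y))
  rw [hψ₂, hψ₂] at hexp
  have hG := gradient_sub_smul_gradient_lipschitz hh hf hLh hLf hsc_h hlip_h hsc_f hlip_f hγ.le x y
  have hψ := (le_div_iff₀' hμh).2 (hexp.trans hG)
  calc
    _ ≤ M * ‖ψ (gradient h x - γ • gradient f x) - ψ (gradient h y - γ • gradient f y)‖ :=
      hlipD _ _
    _ ≤ M * (max (Lh - γ * μf) (γ * Lf - μh) * ‖x - y‖ / μh) := by gcongr
    _ = _ := by ring
end

section
/- Let φ : ℝⁿ → ℝ be differentiable and let a ≤ b be real numbers such that x ↦ φ(x) − (a/2)‖x‖² is convex and x ↦ (b/2)‖x‖² − φ(x) is convex. Then ∇φ is Lipschitz continuous with constant max(|a|, |b|). -/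
open scoped InnerProductSpace

theorem ConvexOn.add_hasFDerivAt_le {E : Type*} [NormedAddCommGroup E] [NormedSpace ℝ E]
    {f : E → ℝ} {f' : E →L[ℝ] ℝ} {x : E} (hf : ConvexOn ℝ Set.univ f)
    (hf' : HasFDerivAt f f' x) (y : E) : f x + f' (y - x) ≤ f y := by
  have hc : ConvexOn ℝ Set.univ (f ∘ AffineMap.lineMap (k := ℝ) x y) := by
    simpa using hf.comp_affineMap (AffineMap.lineMap (k := ℝ) x y)
  have hd : HasDerivAt (f ∘ AffineMap.lineMap (k := ℝ) x y) (f' (y - x)) 0 := by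
    have hl : HasDerivAt (AffineMap.lineMap (k := ℝ) x y) (y - x) (0 : ℝ) :=
      AffineMap.hasDerivAt_lineMap
    exact HasFDerivAt.comp_hasDerivAt (0 : ℝ) (by simpa using hf') hl
  have h := hc.le_slope_of_hasDerivAt (Set.mem_univ 0) (Set.mem_univ 1) one_pos hd
  simp only [slope_def_field, Function.comp_apply, AffineMap.lineMap_apply_zero,
    AffineMap.lineMap_apply_one, sub_zero, div_one] at h
  linarith

section

variable {E : Type*} [NormedAddCommGroup E] [InnerProductSpace ℝ E] [CompleteSpace E]

theorem ConvexOn.add_inner_gradient_le {φ : E → ℝ} {c : ℝ} {x : E}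
    (hc : ConvexOn ℝ Set.univ (fun x => φ x - c / 2 * ‖x‖ ^ 2))
    (hφ : DifferentiableAt ℝ φ x) (y : E) :
    φ x + ⟪gradient φ x, y - x⟫_ℝ + c / 2 * ‖y - x‖ ^ 2 ≤ φ y := by
  have hd := hφ.hasGradientAt.hasFDerivAt.sub
    ((hasStrictFDerivAt_norm_sq x).hasFDerivAt.const_mul (c / 2))
  have h := hc.add_hasFDerivAt_le hd y
  simp only [sub_apply, smul_apply, InnerProductSpace.toDual_apply_apply,
    innerSL_apply_apply, smul_eq_mul, nsmul_eq_mul, Nat.cast_ofNat, inner_sub_right,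
    real_inner_self_eq_norm_sq] at h
  rw [norm_sub_sq_real, inner_sub_right, real_inner_comm x y]
  linarith

/-- Interpolation inequality for the gradient of a function with two-sided curvature bounds. -/
theorem inner_gradient_sub_sub_smul_nonpos {φ : E → ℝ} {a b : ℝ} (hab : a ≤ b)
    (hφ : Differentiable ℝ φ)
    (hlower : ConvexOn ℝ Set.univ (fun x => φ x - a / 2 * ‖x‖ ^ 2))
    (hupper : ConvexOn ℝ Set.univ (fun x => b / 2 * ‖x‖ ^ 2 - φ x)) (x y : E) :
    ⟪gradient φ x - gradient φ y - a • (x - y),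
      gradient φ x - gradient φ y - b • (x - y)⟫_ℝ ≤ 0 := by
  have hupper' : ConvexOn ℝ Set.univ (fun x => (-φ) x - (-b) / 2 * ‖x‖ ^ 2) := by
    convert hupper using 2
    simp only [Pi.neg_apply]
    ring
  have hgrad (u : E) : gradient (-φ) u = -gradient φ u := by
    simp [gradient, fderiv_neg]
  have step (x y : E) (t : ℝ) (D : E)
      (hD : D = gradient φ x - gradient φ y - a • (x - y)) :
      φ y + ⟪gradient φ y, x - y⟫_ℝ + a / 2 * ‖x - y‖ ^ 2 + t * ‖D‖ ^ 2
        ≤ φ x + (b - a) / 2 * t ^ 2 * ‖D‖ ^ 2 := by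
    have h1 := hlower.add_inner_gradient_le (hφ y) (x - t • D)
    have h2 := hupper'.add_inner_gradient_le (hφ x).neg (x - t • D)
    rw [hgrad, sub_sub_cancel_left] at h2
    rw [show x - t • D - y = (x - y) - t • D by abel, norm_sub_sq_real] at h1
    have hDD : ‖D‖ ^ 2 = ⟪gradient φ x, D⟫_ℝ - ⟪gradient φ y, D⟫_ℝ - a * ⟪x - y, D⟫_ℝ := by
      rw [← real_inner_self_eq_norm_sq]
      nth_rw 1 [hD]
      simp only [inner_sub_left, real_inner_smul_left]
    simp only [Pi.neg_apply, norm_neg, norm_smul, mul_pow, Real.norm_eq_abs, sq_abs,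
      inner_neg_left, inner_neg_right, real_inner_smul_right, inner_sub_right (gradient φ y) (x - y)]
      at h1 h2
    linear_combination h1 + h2 + t * hDD
  set d := x - y with hd
  set D := gradient φ x - gradient φ y - a • d with hD
  have key (t : ℝ) : 2 * t * ‖D‖ ^ 2 ≤ ⟪D, d⟫_ℝ + (b - a) * t ^ 2 * ‖D‖ ^ 2 := by
    have h1 := step x y t D hD
    have h2 := step y x t (-D) (by rw [hD, hd]; module)
    rw [norm_neg, ← neg_sub x y, norm_neg, inner_neg_right, ← hd] at h2
    rw [← hd] at h1
    have : ⟪D, d⟫_ℝ = ⟪gradient φ x, d⟫_ℝ - ⟪gradient φ y, d⟫_ℝ - a * ‖d‖ ^ 2 := by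
      rw [hD, inner_sub_left, inner_sub_left, real_inner_smul_left, real_inner_self_eq_norm_sq]
    linear_combination h1 + h2 - this
  have hco : ‖D‖ ^ 2 ≤ (b - a) * ⟪D, d⟫_ℝ := by
    rcases hab.eq_or_lt with rfl | hlt
    · by_contra! hpos
      rw [sub_self, zero_mul] at hpos
      have h := key ((⟪D, d⟫_ℝ + 1) / (2 * ‖D‖ ^ 2))
      have h' : 2 * ((⟪D, d⟫_ℝ + 1) / (2 * ‖D‖ ^ 2)) * ‖D‖ ^ 2 = ⟪D, d⟫_ℝ + 1 := by
        rw [← mul_div_assoc, mul_div_mul_left _ _ two_ne_zero, div_mul_cancel₀ _ hpos.ne']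
      rw [h'] at h
      linarith
    · have hL : 0 < b - a := sub_pos.2 hlt
      have h := mul_le_mul_of_nonneg_left (key (1 / (b - a))) hL.le
      have h1 : (b - a) * (2 * (1 / (b - a)) * ‖D‖ ^ 2) = 2 * ‖D‖ ^ 2 := by field_simp
      have h2 : (b - a) * ((b - a) * (1 / (b - a)) ^ 2 * ‖D‖ ^ 2) = ‖D‖ ^ 2 := by field_simp
      linarith
  have : gradient φ x - gradient φ y - b • d = D - (b - a) • d := by rw [hD]; module
  rw [this, inner_sub_right, real_inner_smul_right, real_inner_self_eq_norm_sq]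
  linarith

end

theorem norm_le_max_abs_mul_norm_of_inner_nonpos {E : Type*} [NormedAddCommGroup E]
    [InnerProductSpace ℝ E] {a b : ℝ} (hab : a ≤ b) {g d : E}
    (h : ⟪g - a • d, g - b • d⟫_ℝ ≤ 0) : ‖g‖ ≤ max |a| |b| * ‖d‖ := by
  have hball : ‖g - ((a + b) / 2) • d‖ ≤ (b - a) / 2 * ‖d‖ := by
    refine le_of_sq_le_sq ?_ (by have := sub_nonneg.2 hab; positivity)
    simp only [inner_sub_left, inner_sub_right, real_inner_smul_left, real_inner_smul_right,
      real_inner_self_eq_norm_sq, real_inner_comm g d] at h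
    rw [norm_sub_sq_real, norm_smul, mul_pow, Real.norm_eq_abs, sq_abs, real_inner_smul_right]
    linear_combination h
  have hmax : (b - a) / 2 + |(a + b) / 2| ≤ max |a| |b| := by
    rcases abs_cases ((a + b) / 2) with ⟨h, _⟩ | ⟨h, _⟩ <;> rw [h]
    · exact le_max_of_le_right (by linarith [le_abs_self b])
    · exact le_max_of_le_left (by linarith [neg_abs_le a])
  calc ‖g‖ = ‖(g - ((a + b) / 2) • d) + ((a + b) / 2) • d‖ := by rw [sub_add_cancel]
    _ ≤ (b - a) / 2 * ‖d‖ + |(a + b) / 2| * ‖d‖ := by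
      refine (norm_add_le _ _).trans (add_le_add hball ?_)
      rw [norm_smul, Real.norm_eq_abs]
    _ = ((b - a) / 2 + |(a + b) / 2|) * ‖d‖ := by ring
    _ ≤ max |a| |b| * ‖d‖ := by gcongr

/-- **Two-sided curvature bounds imply a Lipschitz gradient.** If `φ − (a/2)‖·‖²` and
`(b/2)‖·‖² − φ` are both convex with `a ≤ b`, then `∇φ` is Lipschitz with constant
`max(|a|, |b|)`. -/
theorem gradient_lipschitz_of_curvature_bounds {n : ℕ}
    (φ : EuclideanSpace ℝ (Fin n) → ℝ) (a b : ℝ) (hab : a ≤ b)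
    (hφ : Differentiable ℝ φ)
    (hlower : ConvexOn ℝ Set.univ (fun x => φ x - a / 2 * ‖x‖ ^ 2))
    (hupper : ConvexOn ℝ Set.univ (fun x => b / 2 * ‖x‖ ^ 2 - φ x)) :
    ∀ x y : EuclideanSpace ℝ (Fin n),
      ‖gradient φ x - gradient φ y‖ ≤ max |a| |b| * ‖x - y‖ := by
  exact fun x y => norm_le_max_abs_mul_norm_of_inner_nonpos hab
    (inner_gradient_sub_sub_smul_nonpos hab hφ hlower hupper x y)
end

section
/- Let h, f : ℝⁿ → ℝ be differentiable, with h μ_h-strongly convex with L_h-Lipschitz gradient and f μ_f-strongly convex with L_f-Lipschitz gradient (0 < μ_h ≤ L_h, 0 < μ_f ≤ L_f), and let γ > 0. Then the map x ↦ ∇h(x) − γ∇f(x) is Lipschitz continuous with constant max(L_h − γμ_f, γL_f − μ_h), and this constant is nonnegative. -/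
open scoped InnerProductSpace

/-- The derivative of a function with gradient `G` along a line. -/
lemma HasGradientAt.hasDerivAt_line {F : Type*} [NormedAddCommGroup F] [InnerProductSpace ℝ F]
    [CompleteSpace F] {φ : F → ℝ} {G : F → F} (hφ : ∀ x, HasGradientAt φ (G x) x) (x v : F)
    (t : ℝ) : HasDerivAt (fun s : ℝ => φ (x + s • v)) ⟪G (x + t • v), v⟫_ℝ t := by
  have h1 : HasDerivAt (fun s : ℝ => x + s • v) v t := by
    simpa using ((hasDerivAt_id t).smul_const v).const_add x
  simpa [Function.comp_def] using (hφ (x + t • v)).hasFDerivAt.comp_hasDerivAt t h1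

/-- The gradient of a convex function is a monotone operator. -/
lemma ConvexOn.inner_gradient_sub_nonneg {F : Type*} [NormedAddCommGroup F]
    [InnerProductSpace ℝ F] [CompleteSpace F] {φ : F → ℝ} {G : F → F}
    (hc : ConvexOn ℝ Set.univ φ) (hφ : ∀ x, HasGradientAt φ (G x) x) (x y : F) :
    0 ≤ ⟪G x - G y, x - y⟫_ℝ := by
  have hd := HasGradientAt.hasDerivAt_line hφ y (x - y)
  have hline : ConvexOn ℝ Set.univ (fun s : ℝ => φ (y + s • (x - y))) := by
    have := hc.comp_affineMap (AffineMap.lineMap y x : ℝ →ᵃ[ℝ] F)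
    simpa [Function.comp_def, AffineMap.lineMap_apply, add_comm] using this
  have hm := hline.monotoneOn_deriv (fun t _ => (hd t).differentiableAt)
    (Set.mem_univ 0) (Set.mem_univ 1) zero_le_one
  rw [(hd 0).deriv, (hd 1).deriv] at hm
  simp only [zero_smul, add_zero, one_smul, add_sub_cancel] at hm
  rw [inner_sub_left]
  linarith

/-- The gradient of a `μ`-strongly convex function is `μ`-strongly monotone. -/
lemma ConvexOn.strongly_monotone_gradient {F : Type*} [NormedAddCommGroup F]
    [InnerProductSpace ℝ F] [CompleteSpace F] {f : F → ℝ} {G : F → F} {μ : ℝ}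
    (hc : ConvexOn ℝ Set.univ (fun x => f x - μ / 2 * ‖x‖ ^ 2))
    (hf : ∀ x, HasGradientAt f (G x) x) (x y : F) :
    μ * ‖x - y‖ ^ 2 ≤ ⟪G x - G y, x - y⟫_ℝ := by
  have hg : ∀ z, HasGradientAt (fun x => f x - μ / 2 * ‖x‖ ^ 2) (G z - μ • z) z := by
    intro z
    rw [hasGradientAt_iff_hasFDerivAt]
    refine ((hf z).hasFDerivAt.sub
      ((hasStrictFDerivAt_norm_sq z).hasFDerivAt.const_mul (μ / 2))).congr_fderiv ?_
    ext w
    simp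
    ring
  have h := hc.inner_gradient_sub_nonneg hg x y
  have e : G x - μ • x - (G y - μ • y) = (G x - G y) - μ • (x - y) := by module
  rw [e, inner_sub_left, real_inner_smul_left, real_inner_self_eq_norm_sq] at h
  linarith

/-- The descent lemma, under a one-sided Lipschitz bound on the gradient. -/
lemma HasGradientAt.le_quadratic_of_inner_le {F : Type*} [NormedAddCommGroup F]
    [InnerProductSpace ℝ F] [CompleteSpace F] {φ : F → ℝ} {G : F → F} {M : ℝ}
    (hφ : ∀ x, HasGradientAt φ (G x) x)
    (hM : ∀ x y, ⟪G x - G y, x - y⟫_ℝ ≤ M * ‖x - y‖ ^ 2) (x v : F) :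
    φ (x + v) ≤ φ x + ⟪G x, v⟫_ℝ + M / 2 * ‖v‖ ^ 2 := by
  have hd : ∀ t : ℝ, HasDerivAt
      (fun s : ℝ => φ (x + s • v) - (s * ⟪G x, v⟫_ℝ + s ^ 2 * (M / 2 * ‖v‖ ^ 2)))
      (⟪G (x + t • v), v⟫_ℝ - (⟪G x, v⟫_ℝ + 2 * t * (M / 2 * ‖v‖ ^ 2))) t := by
    intro t
    refine (HasGradientAt.hasDerivAt_line hφ x v t).sub (HasDerivAt.add ?_ ?_)
    · simpa using (hasDerivAt_id t).mul_const ⟪G x, v⟫_ℝ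
    · simpa using (hasDerivAt_pow 2 t).mul_const (M / 2 * ‖v‖ ^ 2)
  have hanti := antitoneOn_of_deriv_nonpos (convex_Icc (0 : ℝ) 1)
    (fun t _ => (hd t).continuousAt.continuousWithinAt)
    (fun t _ => (hd t).differentiableAt.differentiableWithinAt)
    (fun t ht => by
      rw [interior_Icc] at ht
      rw [(hd t).deriv]
      have h := hM (x + t • v) x
      rw [add_sub_cancel_left, real_inner_smul_right, norm_smul, Real.norm_of_nonneg ht.1.le,
        inner_sub_left] at h
      have h' : t * (⟪G (x + t • v), v⟫_ℝ - ⟪G x, v⟫_ℝ) ≤ t * (t * (M * ‖v‖ ^ 2)) := by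
        linarith
      linarith [le_of_mul_le_mul_left h' ht.1])
  have h := hanti (Set.left_mem_Icc.2 zero_le_one) (Set.right_mem_Icc.2 zero_le_one) zero_le_one
  simp only [zero_smul, add_zero, one_smul] at h
  linarith

/-- If `|⟪∇φ x - ∇φ y, x - y⟫| ≤ M ‖x - y‖²` for all `x, y`, then `∇φ` is `M`-Lipschitz. -/
lemma HasGradientAt.norm_sub_le_of_abs_inner_le {F : Type*} [NormedAddCommGroup F]
    [InnerProductSpace ℝ F] [CompleteSpace F] {φ : F → ℝ} {G : F → F} {M : ℝ}
    (hφ : ∀ x, HasGradientAt φ (G x) x)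
    (hM : ∀ x y, |⟪G x - G y, x - y⟫_ℝ| ≤ M * ‖x - y‖ ^ 2) (x y : F) :
    ‖G x - G y‖ ≤ M * ‖x - y‖ := by
  have hub := HasGradientAt.le_quadratic_of_inner_le hφ
    (fun x y => (le_abs_self _).trans (hM x y))
  have hneg : ∀ x, HasGradientAt (fun z => -φ z) (-G x) x := fun x => by
    rw [hasGradientAt_iff_hasFDerivAt, map_neg]
    exact (hφ x).hasFDerivAt.neg
  have hlb := HasGradientAt.le_quadratic_of_inner_le (M := M) hneg (fun x y => by
    rw [← neg_sub', inner_neg_left]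
    exact (neg_le_abs _).trans (hM x y))
  have key : ∀ v : F, ⟪G x - G y, v⟫_ℝ ≤ M / 2 * (‖v‖ ^ 2 + ‖x - y‖ ^ 2) := by
    intro v
    set p := (2⁻¹ : ℝ) • (y - x - v) with hp
    set q := (2⁻¹ : ℝ) • (x - y - v) with hq
    have e1 : x + p = y + q := by rw [hp, hq]; module
    have e2 : x + -q = y + -p := by rw [hp, hq]; module
    have h1 := hub x p
    have h2 := hlb y q
    have h3 := hub y (-p)
    have h4 := hlb x (-q)
    rw [e1] at h1
    rw [e2] at h4
    simp only [inner_neg_left, inner_neg_right, norm_neg] at h1 h2 h3 h4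
    have hv : p + q = -v := by rw [hp, hq]; module
    have hxy : q - p = x - y := by rw [hp, hq]; module
    have hpar := parallelogram_law_with_norm ℝ p q
    rw [hv, norm_neg, norm_sub_rev, hxy] at hpar
    have hv' : v = -(p + q) := by rw [hv, neg_neg]
    have hin : ⟪G x - G y, v⟫_ℝ
        = -(⟪G x, p⟫_ℝ + ⟪G x, q⟫_ℝ - ⟪G y, p⟫_ℝ - ⟪G y, q⟫_ℝ) := by
      rw [hv', inner_neg_right, inner_sub_left, inner_add_right, inner_add_right]
      ring
    have hpar' : ‖v‖ ^ 2 + ‖x - y‖ ^ 2 = 2 * (‖p‖ ^ 2 + ‖q‖ ^ 2) := by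
      linarith
    rw [hpar', hin]
    linarith
  rcases eq_or_ne (G x - G y) 0 with hg | hg
  · rcases eq_or_ne x y with rfl | hxy
    · simp
    · have hpos : 0 < ‖x - y‖ := norm_pos_iff.2 (sub_ne_zero.2 hxy)
      have h := (abs_nonneg _).trans (hM x y)
      rw [hg, norm_zero]
      exact mul_nonneg (nonneg_of_mul_nonneg_left h (by positivity)) hpos.le
  have hgpos : 0 < ‖G x - G y‖ := norm_pos_iff.2 hg
  have hdpos : 0 < ‖x - y‖ := norm_pos_iff.2 (sub_ne_zero.2 fun e => hg (by rw [e, sub_self]))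
  have h := key ((‖x - y‖ / ‖G x - G y‖) • (G x - G y))
  rw [real_inner_smul_right, real_inner_self_eq_norm_sq, norm_smul,
    Real.norm_of_nonneg (by positivity), div_mul_cancel₀ _ hgpos.ne'] at h
  have e : ‖x - y‖ / ‖G x - G y‖ * ‖G x - G y‖ ^ 2 = ‖x - y‖ * ‖G x - G y‖ := by
    field_simp
  rw [e] at h
  refine le_of_mul_le_mul_left ?_ hdpos
  linarith

/-- Upper bound on the inner product of increments of a Lipschitz map. -/
lemma inner_sub_le_of_norm_sub_le {F : Type*} [NormedAddCommGroup F] [InnerProductSpace ℝ F]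
    {G : F → F} {L : ℝ} (hG : ∀ x y, ‖G x - G y‖ ≤ L * ‖x - y‖) (x y : F) :
    ⟪G x - G y, x - y⟫_ℝ ≤ L * ‖x - y‖ ^ 2 := by
  calc ⟪G x - G y, x - y⟫_ℝ ≤ ‖G x - G y‖ * ‖x - y‖ := real_inner_le_norm _ _
    _ ≤ L * ‖x - y‖ * ‖x - y‖ := by gcongr; exact hG x y
    _ = L * ‖x - y‖ ^ 2 := by ring

/-- **Lipschitz constant of the mirror-descent forward map.** If `h` is `μh`-strongly convex
with `Lh`-Lipschitz gradient, `f` is `μf`-strongly convex with `Lf`-Lipschitz gradient, and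
`γ > 0`, then `x ↦ ∇h(x) − γ∇f(x)` is Lipschitz with constant
`max(Lh − γμf, γLf − μh)`, and this constant is nonnegative. -/
theorem forward_map_lipschitz {n : ℕ}
    (h f : EuclideanSpace ℝ (Fin n) → ℝ)
    (μh Lh μf Lf γ : ℝ)
    (hh : Differentiable ℝ h) (hf : Differentiable ℝ f)
    (hμh : 0 < μh) (hLh : μh ≤ Lh) (hμf : 0 < μf) (hLf : μf ≤ Lf)
    (hsc_h : ConvexOn ℝ Set.univ (fun x => h x - μh / 2 * ‖x‖ ^ 2))
    (hlip_h : ∀ x y, ‖gradient h x - gradient h y‖ ≤ Lh * ‖x - y‖)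
    (hsc_f : ConvexOn ℝ Set.univ (fun x => f x - μf / 2 * ‖x‖ ^ 2))
    (hlip_f : ∀ x y, ‖gradient f x - gradient f y‖ ≤ Lf * ‖x - y‖)
    (hγ : 0 < γ) :
    0 ≤ max (Lh - γ * μf) (γ * Lf - μh) ∧
    ∀ x y : EuclideanSpace ℝ (Fin n),
      ‖(gradient h x - γ • gradient f x) - (gradient h y - γ • gradient f y)‖ ≤
        max (Lh - γ * μf) (γ * Lf - μh) * ‖x - y‖ := by
  have gh := fun x => (hh x).hasGradientAt
  have gf := fun x => (hf x).hasGradientAt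
  refine ⟨?_, ?_⟩
  · by_contra! hneg
    obtain ⟨h1, h2⟩ := max_lt_iff.1 hneg
    linarith [mul_le_mul_of_nonneg_left hLf hγ.le]
  refine HasGradientAt.norm_sub_le_of_abs_inner_le (φ := fun x => h x - γ * f x)
    (G := fun x => gradient h x - γ • gradient f x) (fun x => ?_) (fun x y => ?_)
  · rw [hasGradientAt_iff_hasFDerivAt, map_sub, map_smul]
    exact (gh x).hasFDerivAt.sub ((gf x).hasFDerivAt.const_mul γ)
  · have e : gradient h x - γ • gradient f x - (gradient h y - γ • gradient f y)
        = (gradient h x - gradient h y) - γ • (gradient f x - gradient f y) := by module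
    rw [e, inner_sub_left, real_inner_smul_left]
    have h1 := hsc_h.strongly_monotone_gradient gh x y
    have h2 := mul_le_mul_of_nonneg_left (hsc_f.strongly_monotone_gradient gf x y) hγ.le
    have h3 := inner_sub_le_of_norm_sub_le hlip_h x y
    have h4 := mul_le_mul_of_nonneg_left (inner_sub_le_of_norm_sub_le hlip_f x y) hγ.le
    have m1 := mul_le_mul_of_nonneg_right (le_max_left (Lh - γ * μf) (γ * Lf - μh))
      (sq_nonneg ‖x - y‖)
    have m2 := mul_le_mul_of_nonneg_right (le_max_right (Lh - γ * μf) (γ * Lf - μh))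
      (sq_nonneg ‖x - y‖)
    rw [abs_le]
    constructor <;> linarith
end

section
/- Let 0 < μ_h ≤ L_h, 0 < μ_f ≤ L_f with L_h·L_f > μ_h·μ_f, and let M > 0 satisfy M < μ_h(μ_f + L_f)/(L_h L_f − μ_h μ_f). Then (μ_h/μ_f)(L_h/μ_h − 1/M) < (μ_h/L_f)(1 + 1/M), and for every γ with (μ_h/μ_f)(L_h/μ_h − 1/M) < γ < (μ_h/L_f)(1 + 1/M) one has (M/μ_h)·max(L_h − γμ_f, γL_f − μ_h) < 1. -/
/-- **The PnP-BPGM contraction condition.** For positive parameters `0 < μh ≤ Lh`,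
`0 < μf ≤ Lf` with `Lh·Lf > μh·μf` and `0 < M < μh(μf + Lf)/(Lh Lf − μh μf)`, the step-size
interval `((μh/μf)(Lh/μh − 1/M), (μh/Lf)(1 + 1/M))` is nonempty, and any `γ` in it makes
`(M/μh)·max(Lh − γμf, γLf − μh) < 1`. -/
theorem pnp_bpgm_contraction_condition
    (μh Lh μf Lf M : ℝ)
    (hμh : 0 < μh) (hLh : μh ≤ Lh) (hμf : 0 < μf) (hLf : μf ≤ Lf)
    (hprod : μh * μf < Lh * Lf)
    (hM : 0 < M)
    (hMbound : M < μh * (μf + Lf) / (Lh * Lf - μh * μf)) :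
    μh / μf * (Lh / μh - 1 / M) < μh / Lf * (1 + 1 / M) ∧
    ∀ γ : ℝ, μh / μf * (Lh / μh - 1 / M) < γ → γ < μh / Lf * (1 + 1 / M) →
      M / μh * max (Lh - γ * μf) (γ * Lf - μh) < 1 := by
  have hLf_pos : 0 < Lf := hμf.trans_le hLf
  have lower_eq : μh / μf * (Lh / μh - 1 / M) = (Lh - μh / M) / μf := by
    field_simp
  have upper_eq : μh / Lf * (1 + 1 / M) = (μh + μh / M) / Lf := by
    field_simp
  rw [lower_eq, upper_eq]
  refine ⟨?_, fun γ hlower hupper => ?_⟩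
  · rw [lt_div_iff₀ (sub_pos.2 hprod)] at hMbound
    have hquot : Lh * Lf - μh * μf < μh / M * (μf + Lf) := by
      rw [div_mul_eq_mul_div, lt_div_iff₀ hM]
      linarith
    rw [div_lt_div_iff₀ hμf hLf_pos]
    linarith
  · rw [div_lt_iff₀ hμf] at hlower
    rw [lt_div_iff₀ hLf_pos] at hupper
    have hmax : max (Lh - γ * μf) (γ * Lf - μh) < μh / M :=
      max_lt (by linarith) (by linarith)
    calc M / μh * max (Lh - γ * μf) (γ * Lf - μh)
        < M / μh * (μh / M) := mul_lt_mul_of_pos_left hmax (div_pos hM hμh)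
      _ = 1 := by field_simp
end

section
/- Let f, h : ℝⁿ → ℝ be differentiable and L > 0. Then the function x ↦ L·h(x) − f(x) is convex if and only if for all x, y ∈ ℝⁿ: f(x) ≤ f(y) + ⟨∇f(y), x − y⟩ + L·B_h(x, y), where B_h(x, y) = h(x) − h(y) − ⟨∇h(y), x − y⟩ is the Bregman distance. -/
open scoped InnerProductSpace

/-- First-order characterization of convexity: a differentiable function is convex if and only
if it lies above all of its tangent hyperplanes. -/
theorem convexOn_univ_iff_forall_tangent_le {E : Type*} [NormedAddCommGroup E] [NormedSpace ℝ E]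
    {g : E → ℝ} {g' : E → E →L[ℝ] ℝ} (hg : ∀ x, HasFDerivAt g (g' x) x) :
    ConvexOn ℝ Set.univ g ↔ ∀ x y, g y + g' y (x - y) ≤ g x := by
  constructor
  · intro hc x y
    have hconv : ConvexOn ℝ Set.univ (g ∘ AffineMap.lineMap (k := ℝ) y x) := by
      simpa using hc.comp_affineMap (AffineMap.lineMap (k := ℝ) y x)
    have hderiv : HasDerivAt (g ∘ AffineMap.lineMap (k := ℝ) y x) (g' y (x - y)) (0 : ℝ) := by
      refine HasFDerivAt.comp_hasDerivAt (0 : ℝ) ?_ AffineMap.hasDerivAt_lineMap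
      simpa using hg y
    have hslope := hconv.le_slope_of_hasDerivAt (Set.mem_univ 0) (Set.mem_univ 1) one_pos hderiv
    simp only [slope_def_field, Function.comp_apply, AffineMap.lineMap_apply_zero,
      AffineMap.lineMap_apply_one, sub_zero, div_one] at hslope
    linarith
  · refine fun H => ⟨convex_univ, fun x _ y _ a b ha hb hab => ?_⟩
    set z := a • x + b • y with hz
    have hcancel : a * g' z (x - z) + b * g' z (y - z) = 0 := by
      have hvec : a • (x - z) + b • (y - z) = 0 := by
        rw [smul_sub, smul_sub, sub_add_sub_comm, ← add_smul, hab, one_smul, ← hz, sub_self]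
      simpa only [map_add, map_smul, smul_eq_mul, map_zero] using congrArg (g' z) hvec
    have hx := mul_le_mul_of_nonneg_left (H x z) ha
    have hy := mul_le_mul_of_nonneg_left (H y z) hb
    have hsum : a * g z + b * g z = g z := by rw [← add_mul, hab, one_mul]
    simp only [smul_eq_mul]
    linarith

/-- **Relative smoothness as a Bregman majorization.** For differentiable `f, h : ℝⁿ → ℝ`
and `L > 0`, the function `L·h − f` is convex if and only if
`f(x) ≤ f(y) + ⟨∇f(y), x − y⟩ + L·B_h(x, y)` for all `x, y`, where
`B_h(x, y) = h(x) − h(y) − ⟨∇h(y), x − y⟩` is the Bregman distance. -/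
theorem relative_smoothness_iff_bregman_majorization {n : ℕ}
    (f h : EuclideanSpace ℝ (Fin n) → ℝ) (L : ℝ) (hL : 0 < L)
    (hf : Differentiable ℝ f) (hh : Differentiable ℝ h) :
    ConvexOn ℝ Set.univ (fun x => L * h x - f x) ↔
    ∀ x y : EuclideanSpace ℝ (Fin n),
      f x ≤ f y + ⟪gradient f y, x - y⟫_ℝ +
        L * (h x - h y - ⟪gradient h y, x - y⟫_ℝ) := by
  have hg (y : EuclideanSpace ℝ (Fin n)) :
      HasFDerivAt (fun x => L * h x - f x) (L • fderiv ℝ h y - fderiv ℝ f y) y :=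
    ((hh y).hasFDerivAt.const_mul L).sub (hf y).hasFDerivAt
  rw [convexOn_univ_iff_forall_tangent_le hg]
  refine forall₂_congr fun x y => ?_
  simp only [← toDual_gradient, sub_apply, smul_apply,
    InnerProductSpace.toDual_apply_apply, smul_eq_mul]
  constructor <;> intro H <;> linarith
end

section
/- Let h : ℝⁿ → ℝ be differentiable and μ-strongly convex with μ > 0, let g : ℝⁿ → ℝ be convex and continuous, and fix z ∈ ℝⁿ. Then the function x ↦ B_h(x, z) + g(x) attains its minimum over ℝⁿ at exactly one point; i.e., the Bregman proximal operator prox_g^h(z) = argmin_x { B_h(x, z) + g(x) } is well-defined and single-valued. -/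
open scoped InnerProductSpace

/-- Adding a convex function to a strongly convex one preserves strong convexity. -/
lemma StrongConvexOn.add_convexOn {E : Type*} [NormedAddCommGroup E] [NormedSpace ℝ E]
    {s : Set E} {m : ℝ} {f g : E → ℝ} (hf : StrongConvexOn s m f) (hg : ConvexOn ℝ s g) :
    StrongConvexOn s m (f + g) := by
  simpa [StrongConvexOn] using UniformConvexOn.add hf (uniformConvexOn_zero.2 hg)

/-- A continuous strongly convex function on a proper space is bounded below by its value at the
origin outside a bounded set. -/
lemma StrongConvexOn.eventually_cocompact_le {E : Type*} [NormedAddCommGroup E] [NormedSpace ℝ E]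
    [ProperSpace E] {m : ℝ} {f : E → ℝ} (hf : StrongConvexOn Set.univ m f) (hm : 0 < m)
    (hfc : Continuous f) : ∀ᶠ x in Filter.cocompact E, f 0 ≤ f x := by
  obtain ⟨y, -, hy⟩ := (isCompact_closedBall (0 : E) 1).exists_isMinOn
    ⟨0, Metric.mem_closedBall_self zero_le_one⟩ hfc.continuousOn
  filter_upwards [(tendsto_norm_cocompact_atTop (E := E)).eventually_ge_atTop
    (1 + 2 * (f 0 - f y) / m), (tendsto_norm_cocompact_atTop (E := E)).eventually_ge_atTop 1]
    with x hx hx1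
  have hr : 0 < ‖x‖ := by linarith
  have hball : f y ≤ f (‖x‖⁻¹ • x) := hy <| by
    simp [norm_smul, inv_mul_cancel₀ hr.ne']
  have hconv := hf.2 (Set.mem_univ x) (Set.mem_univ 0) (inv_nonneg.2 hr.le)
    (sub_nonneg.2 (inv_le_one_of_one_le₀ hx1)) (by ring : ‖x‖⁻¹ + (1 - ‖x‖⁻¹) = 1)
  simp only [smul_zero, add_zero, sub_zero, smul_eq_mul] at hconv
  have hmod : ‖x‖⁻¹ * (1 - ‖x‖⁻¹) * (m / 2 * ‖x‖ ^ 2) = m / 2 * (‖x‖ - 1) := by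
    field_simp
  have hlarge : f 0 - f y ≤ m / 2 * (‖x‖ - 1) := by
    have := (div_le_iff₀ hm).1 (le_sub_iff_add_le'.2 hx)
    linarith
  have hscaled : 0 ≤ ‖x‖⁻¹ * (f x - f 0) := by linarith
  exact sub_nonneg.1 (nonneg_of_mul_nonneg_right hscaled (inv_pos.2 hr))

/-- A continuous strongly convex function on a proper space has a unique global minimizer. -/
lemma StrongConvexOn.existsUnique_forall_le {E : Type*} [NormedAddCommGroup E] [NormedSpace ℝ E]
    [ProperSpace E] {m : ℝ} {f : E → ℝ} (hf : StrongConvexOn Set.univ m f) (hm : 0 < m)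
    (hfc : Continuous f) : ∃! x, ∀ y, f x ≤ f y := by
  obtain ⟨x, hx⟩ := hfc.exists_forall_le' 0 (hf.eventually_cocompact_le hm hfc)
  exact ⟨x, hx, fun y hy ↦ (hf.strictConvexOn hm).eq_of_isMinOn (fun z _ ↦ hy z)
    (fun z _ ↦ hx z) (Set.mem_univ y) (Set.mem_univ x)⟩

/-- **Well-posedness of the Bregman proximal operator.** If `h` is differentiable and
`μ`-strongly convex and `g` is convex and continuous, then for every `z` the function
`x ↦ B_h(x, z) + g(x)` has a unique global minimizer, so the Bregman proximal operator
`prox_g^h(z) = argmin_x { B_h(x, z) + g(x) }` is well-defined and single-valued. -/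
theorem bregman_prox_well_defined {n : ℕ}
    (h : EuclideanSpace ℝ (Fin n) → ℝ) (μ : ℝ) (hμ : 0 < μ)
    (hh : Differentiable ℝ h)
    (hsc : ConvexOn ℝ Set.univ (fun x => h x - μ / 2 * ‖x‖ ^ 2))
    (g : EuclideanSpace ℝ (Fin n) → ℝ)
    (hg : ConvexOn ℝ Set.univ g) (hgc : Continuous g)
    (z : EuclideanSpace ℝ (Fin n)) :
    ∃! xm : EuclideanSpace ℝ (Fin n),
      ∀ x : EuclideanSpace ℝ (Fin n),
        (h xm - h z - ⟪gradient h z, xm - z⟫_ℝ) + g xm ≤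
          (h x - h z - ⟪gradient h z, x - z⟫_ℝ) + g x := by
  have hlin : ConvexOn ℝ Set.univ fun x ↦ -h z - ⟪gradient h z, x - z⟫_ℝ := by
    refine ⟨convex_univ, fun x _ y _ a b _ _ hab ↦ le_of_eq ?_⟩
    obtain rfl : b = 1 - a := by linarith
    simp only [inner_sub_right, inner_add_right, real_inner_smul_right, smul_eq_mul]
    ring
  have hF := ((strongConvexOn_iff_convex.2 hsc).add_convexOn hlin).add_convexOn hg
  have hFc : Continuous (h + (fun x ↦ -h z - ⟪gradient h z, x - z⟫_ℝ) + g) := by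
    have := hh.continuous
    fun_prop
  convert hF.existsUnique_forall_le hμ hFc using 5 <;> simp only [Pi.add_apply] <;> ring
end

section
/- Let h : ℝⁿ → ℝ be differentiable and μ-strongly convex (μ > 0), let f : ℝⁿ → ℝ be differentiable, let g : ℝⁿ → ℝ be convex and differentiable, let γ > 0, and fix x ∈ ℝⁿ. Then a point x⁺ ∈ ℝⁿ minimizes the function u ↦ ⟨∇f(x), u⟩ + (1/γ)·B_h(u, x) + g(u) over ℝⁿ if and only if ∇h(x⁺) + γ∇g(x⁺) = ∇h(x) − γ∇f(x). -/
open scoped InnerProductSpace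

/-- A critical point of a convex function is a global minimizer. -/
theorem ConvexOn.le_of_hasFDerivAt_zero {E : Type*} [NormedAddCommGroup E] [NormedSpace ℝ E]
    {F : E → ℝ} (hF : ConvexOn ℝ Set.univ F) {a : E}
    (ha : HasFDerivAt F (0 : E →L[ℝ] ℝ) a) (u : E) : F a ≤ F u := by
  have hconv : ConvexOn ℝ Set.univ (F ∘ AffineMap.lineMap (k := ℝ) a u) := by
    simpa using hF.comp_affineMap (AffineMap.lineMap (k := ℝ) a u)
  have hderiv : HasDerivAt (F ∘ AffineMap.lineMap (k := ℝ) a u) 0 0 := by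
    have hline : HasDerivAt (AffineMap.lineMap (k := ℝ) a u) (u - a) 0 :=
      AffineMap.hasDerivAt_lineMap
    have ha' : HasFDerivAt F (0 : E →L[ℝ] ℝ) (AffineMap.lineMap (k := ℝ) a u 0) := by
      simpa using ha
    simpa using ha'.comp_hasDerivAt (0 : ℝ) hline
  have hslope := hconv.le_slope_of_hasDerivAt (Set.mem_univ 0) (Set.mem_univ 1) one_pos hderiv
  simpa [slope_def_field] using hslope

/-- A convex differentiable function is minimized exactly where its derivative vanishes. -/
theorem ConvexOn.forall_le_iff_of_hasFDerivAt {E : Type*} [NormedAddCommGroup E]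
    [NormedSpace ℝ E] {F : E → ℝ} (hF : ConvexOn ℝ Set.univ F) {a : E} {F' : E →L[ℝ] ℝ}
    (ha : HasFDerivAt F F' a) : (∀ u, F a ≤ F u) ↔ F' = 0 := by
  refine ⟨fun hmin => ?_, fun h0 => hF.le_of_hasFDerivAt_zero (h0 ▸ ha)⟩
  exact IsLocalMin.hasFDerivAt_eq_zero (Filter.Eventually.of_forall hmin) ha

/-- A function that is convex after subtracting a nonnegative multiple of the squared norm is
convex. -/
theorem ConvexOn.of_sub_mul_sq_norm {E : Type*} [NormedAddCommGroup E] [NormedSpace ℝ E]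
    {h : E → ℝ} {c : ℝ} (hc : 0 ≤ c)
    (hsc : ConvexOn ℝ Set.univ (fun x => h x - c * ‖x‖ ^ 2)) : ConvexOn ℝ Set.univ h := by
  have hsq : ConvexOn ℝ Set.univ (fun x : E => ‖x‖ ^ 2) :=
    convexOn_univ_norm.pow (fun _ _ => norm_nonneg _) 2
  have hsum := hsc.add (hsq.smul hc)
  exact hsum.congr fun x _ => by simp

/-- The Bregman proximal objective is convex when `h` and `g` are. -/
theorem convexOn_bregman_prox_objective {E : Type*} [NormedAddCommGroup E]
    [InnerProductSpace ℝ E] {h g : E → ℝ} {γ : ℝ} (hγ : 0 ≤ γ)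
    (hh : ConvexOn ℝ Set.univ h) (hg : ConvexOn ℝ Set.univ g) (p q x : E) (c : ℝ) :
    ConvexOn ℝ Set.univ
      (fun u => ⟪p, u⟫_ℝ + 1 / γ * (h u - c - ⟪q, u - x⟫_ℝ) + g u) := by
  have hlin : ∀ v : E, ConvexOn ℝ Set.univ (fun u : E => ⟪v, u⟫_ℝ) := fun v =>
    (innerₛₗ ℝ v).convexOn convex_univ
  have hbreg := (((hh.add (hlin (-q))).add_const (⟪q, x⟫_ℝ - c)).smul (one_div_nonneg.2 hγ))
  refine (((hlin p).add hbreg).add hg).congr fun u _ => ?_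
  simp only [Pi.add_apply, inner_sub_right, inner_neg_left, smul_eq_mul]
  ring

/-- The gradient of the Bregman proximal objective. -/
theorem hasGradientAt_bregman_prox_objective {E : Type*} [NormedAddCommGroup E]
    [InnerProductSpace ℝ E] [CompleteSpace E] {h g : E → ℝ} {h' g' a : E}
    (hh : HasGradientAt h h' a) (hg : HasGradientAt g g' a) (γ : ℝ) (p q x : E) (c : ℝ) :
    HasGradientAt (fun u => ⟪p, u⟫_ℝ + 1 / γ * (h u - c - ⟪q, u - x⟫_ℝ) + g u)
      (p + (1 / γ) • (h' - q) + g') a := by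
  rw [hasGradientAt_iff_hasFDerivAt] at *
  have hlin : ∀ v : E, HasFDerivAt (fun u : E => ⟪v, u⟫_ℝ) (InnerProductSpace.toDual ℝ E v) a :=
    fun v => (InnerProductSpace.toDual ℝ E v).hasFDerivAt
  have hbreg := (((hh.sub_const c).sub ((hlin q).sub_const ⟪q, x⟫_ℝ)).const_mul (1 / γ))
  refine ((((hlin p).add hbreg).add hg).congr_fderiv ?_).congr_of_eventuallyEq
    (Filter.Eventually.of_forall fun u => ?_)
  · simp only [map_add, map_sub, map_smul]
  · simp [inner_sub_right]

/-- **First-order characterization of the Bregman proximal gradient step.** For `h`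
differentiable and `μ`-strongly convex, `f` differentiable, `g` convex and differentiable,
and `γ > 0`, a point `x⁺` minimizes `u ↦ ⟨∇f(x), u⟩ + (1/γ)·B_h(u, x) + g(u)` if and only
if `∇h(x⁺) + γ∇g(x⁺) = ∇h(x) − γ∇f(x)`. -/
theorem bregman_prox_grad_step_characterization {n : ℕ}
    (h f g : EuclideanSpace ℝ (Fin n) → ℝ) (μ γ : ℝ) (hμ : 0 < μ) (hγ : 0 < γ)
    (hh : Differentiable ℝ h)
    (hsc : ConvexOn ℝ Set.univ (fun x => h x - μ / 2 * ‖x‖ ^ 2))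
    (hf : Differentiable ℝ f)
    (hg : Differentiable ℝ g) (hgconv : ConvexOn ℝ Set.univ g)
    (x xplus : EuclideanSpace ℝ (Fin n)) :
    (∀ u : EuclideanSpace ℝ (Fin n),
        ⟪gradient f x, xplus⟫_ℝ +
          1 / γ * (h xplus - h x - ⟪gradient h x, xplus - x⟫_ℝ) + g xplus ≤
        ⟪gradient f x, u⟫_ℝ +
          1 / γ * (h u - h x - ⟪gradient h x, u - x⟫_ℝ) + g u) ↔
    gradient h xplus + γ • gradient g xplus = gradient h x - γ • gradient f x := by
  have hconv := convexOn_bregman_prox_objective hγ.le (hsc.of_sub_mul_sq_norm (by positivity))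
    hgconv (gradient f x) (gradient h x) x (h x)
  have hgrad := hasGradientAt_bregman_prox_objective (hh xplus).hasGradientAt
    (hg xplus).hasGradientAt γ (gradient f x) (gradient h x) x (h x)
  rw [hconv.forall_le_iff_of_hasFDerivAt hgrad.hasFDerivAt, map_eq_zero_iff _
    (InnerProductSpace.toDual ℝ (EuclideanSpace ℝ (Fin n))).injective,
    ← smul_right_inj hγ.ne', smul_zero, ← sub_eq_zero (a := gradient h xplus + _)]
  simp only [smul_add, smul_smul, mul_one_div_cancel hγ.ne', one_smul]
  rw [show γ • gradient f x + (gradient h xplus - gradient h x) + γ • gradient g xplus =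
    gradient h xplus + γ • gradient g xplus - (gradient h x - γ • gradient f x) by abel]
end

section
/- Let a₁, …, a_m ∈ ℝⁿ have nonnegative entries with each aᵢ ≠ 0, let y ∈ ℝ^m have nonnegative entries, and let f(x) = Σᵢ (⟨aᵢ, x⟩ − yᵢ·log⟨aᵢ, x⟩) be the Poisson data-fidelity term on the positive orthant P = { x ∈ ℝⁿ : xⱼ > 0 for all j }. Let h(x) = −Σⱼ log xⱼ be Burg's entropy. Then for every L ≥ Σᵢ yᵢ = ‖y‖₁, the function x ↦ L·h(x) − f(x) is convex on P. -/
open scoped InnerProductSpace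

/-- A nonnegative combination of log-convex functions is log-convex. -/
theorem convexOn_log_sum_mul_exp {E ι : Type*} [AddCommGroup E] [Module ℝ E] [Fintype ι]
    {s : Set E} (hs : Convex ℝ s) {b : ι → ℝ} (hb : ∀ j, 0 ≤ b j) (hb' : ∃ j, 0 < b j)
    {c : ι → E → ℝ} (hc : ∀ j, ConvexOn ℝ s (c j)) :
    ConvexOn ℝ s (fun x => Real.log (∑ j, b j * Real.exp (c j x))) := by
  have hpos : ∀ x, 0 < ∑ j, b j * Real.exp (c j x) := fun x => by
    obtain ⟨j, hj⟩ := hb'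
    exact Finset.sum_pos' (fun i _ => mul_nonneg (hb i) (Real.exp_pos _).le)
      ⟨j, Finset.mem_univ j, mul_pos hj (Real.exp_pos _)⟩
  have hnorm : ∀ x, ∑ j, b j *
      Real.exp (c j x - Real.log (∑ j, b j * Real.exp (c j x))) = 1 := fun x => by
    simp_rw [Real.exp_sub, Real.exp_log (hpos x), ← mul_div_assoc, ← Finset.sum_div]
    exact div_self (hpos x).ne'
  refine ⟨hs, fun x hx w hw p q hp hq hpq => ?_⟩
  simp only [smul_eq_mul]
  set A := Real.log (∑ j, b j * Real.exp (c j x))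
  set B := Real.log (∑ j, b j * Real.exp (c j w))
  rw [Real.log_le_iff_le_exp (hpos _), ← div_le_one (Real.exp_pos _), Finset.sum_div]
  calc ∑ j, b j * Real.exp (c j (p • x + q • w)) / Real.exp (p * A + q * B)
      ≤ ∑ j, (p * (b j * Real.exp (c j x - A)) + q * (b j * Real.exp (c j w - B))) := by
        refine Finset.sum_le_sum fun j _ => ?_
        have hcj := (hc j).2 hx hw hp hq hpq
        have hexp := convexOn_exp.2 (Set.mem_univ (c j x - A)) (Set.mem_univ (c j w - B))
          hp hq hpq
        simp only [smul_eq_mul] at hcj hexp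
        have hle : Real.exp (c j (p • x + q • w) - (p * A + q * B)) ≤
            p * Real.exp (c j x - A) + q * Real.exp (c j w - B) :=
          (Real.exp_le_exp.2 (by linarith)).trans hexp
        rw [mul_div_assoc, ← Real.exp_sub]
        linarith [mul_le_mul_of_nonneg_left hle (hb j)]
    _ = 1 := by
        rw [Finset.sum_add_distrib, ← Finset.mul_sum, ← Finset.mul_sum, hnorm, hnorm]
        linarith

theorem convex_positive_orthant (n : ℕ) :
    Convex ℝ {x : EuclideanSpace ℝ (Fin n) | ∀ j, 0 < x j} := by
  intro x hx w hw p q hp hq hpq j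
  exact convex_Ioi (0 : ℝ) (hx j) (hw j) hp hq hpq

theorem convexOn_neg_sum_log {n : ℕ} (t : Finset (Fin n)) :
    ConvexOn ℝ {x : EuclideanSpace ℝ (Fin n) | ∀ j, 0 < x j}
      (fun x => -∑ j ∈ t, Real.log (x j)) := by
  refine ⟨convex_positive_orthant n, fun x hx w hw p q hp hq hpq => ?_⟩
  have hsum := Finset.sum_le_sum fun j (_ : j ∈ t) =>
    strictConcaveOn_log_Ioi.concaveOn.2 (hx j) (hw j) hp hq hpq
  simp only [smul_eq_mul, Finset.sum_add_distrib, ← Finset.mul_sum] at hsum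
  simp only [smul_eq_mul, PiLp.add_apply, PiLp.smul_apply]
  linarith

/-- For nonzero `a ≥ 0`, the function `x ↦ -log ⟨a, x⟩` is `1`-smooth relative to Burg's entropy. -/
theorem convexOn_log_inner_sub_sum_log {n : ℕ} {a : EuclideanSpace ℝ (Fin n)}
    (ha : ∀ j, 0 ≤ a j) (ha_ne : a ≠ 0) :
    ConvexOn ℝ {x : EuclideanSpace ℝ (Fin n) | ∀ j, 0 < x j}
      (fun x => Real.log ⟪a, x⟫_ℝ - ∑ j, Real.log (x j)) := by
  have hex : ∃ j, 0 < a j := by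
    by_contra! hle
    exact ha_ne (by ext j; exact le_antisymm (hle j) (ha j))
  refine (convexOn_log_sum_mul_exp (convex_positive_orthant n) ha hex
    fun j => convexOn_neg_sum_log (Finset.univ.erase j)).congr fun x hx => ?_
  have hinner : ⟪a, x⟫_ℝ = ∑ j, a j * x j := by
    simp [PiLp.inner_apply, mul_comm]
  have hpos : 0 < ∑ j, a j * x j := by
    obtain ⟨j, hj⟩ := hex
    exact Finset.sum_pos' (fun i _ => mul_nonneg (ha i) (hx i).le)
      ⟨j, Finset.mem_univ j, mul_pos hj (hx j)⟩
  have hfactor : ∑ j, a j * Real.exp (-∑ k ∈ Finset.univ.erase j, Real.log (x k)) =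
      (∑ j, a j * x j) * Real.exp (-∑ k, Real.log (x k)) := by
    rw [Finset.sum_mul]
    refine Finset.sum_congr rfl fun j _ => ?_
    rw [← Finset.add_sum_erase _ _ (Finset.mem_univ j), neg_add, Real.exp_add,
      Real.exp_neg (Real.log _), Real.exp_log (hx j), mul_assoc,
      mul_inv_cancel_left₀ (hx j).ne']
  simp only [hfactor, hinner]
  rw [Real.log_mul hpos.ne' (Real.exp_pos _).ne', Real.log_exp, sub_eq_add_neg]

/-- **Relative smoothness of the Poisson fidelity w.r.t. Burg's entropy.** With nonnegative
nonzero measurement vectors `aᵢ`, nonnegative data `y`, the Poisson data-fidelity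
`f(x) = Σᵢ (⟨aᵢ, x⟩ − yᵢ log⟨aᵢ, x⟩)` and Burg's entropy `h(x) = −Σⱼ log xⱼ`, the function
`L·h − f` is convex on the positive orthant for every `L ≥ Σᵢ yᵢ = ‖y‖₁`. -/
theorem poisson_relative_smoothness_burg {n m : ℕ}
    (a : Fin m → EuclideanSpace ℝ (Fin n))
    (ha_nonneg : ∀ i j, 0 ≤ a i j) (ha_ne : ∀ i, a i ≠ 0)
    (y : Fin m → ℝ) (hy : ∀ i, 0 ≤ y i)
    (f h : EuclideanSpace ℝ (Fin n) → ℝ)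
    (hf : f = fun x => ∑ i, (⟪a i, x⟫_ℝ - y i * Real.log ⟪a i, x⟫_ℝ))
    (hh : h = fun x => -∑ j, Real.log (x j))
    (P : Set (EuclideanSpace ℝ (Fin n)))
    (hP : P = {x | ∀ j, 0 < x j}) :
    ∀ L : ℝ, (∑ i, y i) ≤ L → ConvexOn ℝ P (fun x => L * h x - f x) := by
  intro L hL
  subst hf hh hP
  have hterm : ∀ i, ConvexOn ℝ {x : EuclideanSpace ℝ (Fin n) | ∀ j, 0 < x j}
      (fun x => y i * (Real.log ⟪a i, x⟫_ℝ - ∑ j, Real.log (x j)) - ⟪a i, x⟫_ℝ) := fun i =>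
    ((convexOn_log_inner_sub_sum_log (ha_nonneg i) (ha_ne i)).smul (hy i)).sub
      ((innerₗ _ (a i)).concaveOn (convex_positive_orthant n))
  refine ⟨convex_positive_orthant n, fun x hx w hw p q hp hq hpq => ?_⟩
  have hburg := ((convexOn_neg_sum_log Finset.univ).smul (sub_nonneg.2 hL)).2
    hx hw hp hq hpq
  have hsum := Finset.sum_le_sum fun i (_ : i ∈ Finset.univ) => (hterm i).2 hx hw hp hq hpq
  simp only [smul_eq_mul, Finset.sum_add_distrib, Finset.sum_sub_distrib, mul_sub,
    ← Finset.mul_sum, ← Finset.sum_mul] at hburg hsum ⊢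
  linarith
end

section
/- Let D : ℝⁿ → ℝⁿ be differentiable, and suppose that for every x ∈ ℝⁿ the Jacobian J_D(x) (the Fréchet derivative of D at x) is self-adjoint and satisfies J_D(x)·x = D(x). Then for every τ > 0, the function g(x) = (τ/2)·⟨x, x − D(x)⟩ is differentiable with gradient ∇g(x) = τ·(x − D(x)). -/
open scoped InnerProductSpace

/-- **Gradient of the RED regularizer.** If the denoiser `D` is differentiable with
self-adjoint Jacobian satisfying local homogeneity `J_D(x)·x = D(x)`, then the RED
regularizer `g(x) = (τ/2)⟨x, x − D(x)⟩` is differentiable with gradient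
`∇g(x) = τ(x − D(x))`. -/
theorem red_regularizer_gradient {n : ℕ}
    (D : EuclideanSpace ℝ (Fin n) → EuclideanSpace ℝ (Fin n))
    (hD : Differentiable ℝ D)
    (hsym : ∀ x u v : EuclideanSpace ℝ (Fin n),
      ⟪fderiv ℝ D x u, v⟫_ℝ = ⟪u, fderiv ℝ D x v⟫_ℝ)
    (hhom : ∀ x : EuclideanSpace ℝ (Fin n), fderiv ℝ D x x = D x)
    (τ : ℝ) (hτ : 0 < τ) :
    ∀ x : EuclideanSpace ℝ (Fin n),
      HasGradientAt (fun u => τ / 2 * ⟪u, u - D u⟫_ℝ) (τ • (x - D x)) x := by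
  intro x
  rw [hasGradientAt_iff_hasFDerivAt]
  have h := ((hasFDerivAt_id x).inner ℝ
    ((hasFDerivAt_id x).sub (hD x).hasFDerivAt)).const_mul (τ / 2)
  refine h.congr_fderiv ?_
  ext1 v
  have hv : ⟪x, fderiv ℝ D x v⟫_ℝ = ⟪D x, v⟫_ℝ := by rw [← hsym, hhom]
  simp [fderivInnerCLM_apply, inner_sub_right, hv, real_inner_comm v]
  ring
end

section
/- Let h : ℝⁿ → ℝ be differentiable and μ-strongly convex with μ > 0. Then ∇h : ℝⁿ → ℝⁿ is a bijection; in particular, for every u ∈ ℝⁿ there exists a unique x ∈ ℝⁿ with ∇h(x) = u, so the inverse map ψ = (∇h)⁻¹ (equal to the gradient ∇h* of the Fenchel conjugate of h) is well-defined on all of ℝⁿ. -/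
open scoped InnerProductSpace

open Set Filter

/-- A convex function lies above its tangent hyperplanes. -/
theorem ConvexOn.add_fderiv_apply_sub_le {E : Type*} [NormedAddCommGroup E] [NormedSpace ℝ E]
    {s : Set E} {f : E → ℝ} {f' : E →L[ℝ] ℝ} {x y : E} (hf : ConvexOn ℝ s f)
    (hx : x ∈ s) (hy : y ∈ s) (hd : HasFDerivAt f f' x) :
    f x + f' (y - x) ≤ f y := by
  have hline : ConvexOn ℝ (AffineMap.lineMap x y ⁻¹' s) (f ∘ AffineMap.lineMap (k := ℝ) x y) :=
    hf.comp_affineMap _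
  have hderiv : HasDerivAt (f ∘ AffineMap.lineMap (k := ℝ) x y) (f' (y - x)) 0 :=
    HasFDerivAt.comp_hasDerivAt (0 : ℝ) (by simpa using hd) AffineMap.hasDerivAt_lineMap
  have hslope := hline.le_slope_of_hasDerivAt (by simpa using hx) (by simpa using hy)
    zero_lt_one hderiv
  simp only [slope_def_field, Function.comp_apply, AffineMap.lineMap_apply_zero,
    AffineMap.lineMap_apply_one, sub_zero, div_one] at hslope
  linarith

section StrongConvexity

variable {E : Type*} [NormedAddCommGroup E] [InnerProductSpace ℝ E]

/-- A strongly convex function lies above its tangent paraboloids. -/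
theorem StrongConvexOn.add_fderiv_apply_sub_add_le {s : Set E} {f : E → ℝ} {f' : E →L[ℝ] ℝ}
    {μ : ℝ} {x y : E} (hf : StrongConvexOn s μ f) (hx : x ∈ s) (hy : y ∈ s)
    (hd : HasFDerivAt f f' x) :
    f x + f' (y - x) + μ / 2 * ‖y - x‖ ^ 2 ≤ f y := by
  have hsq := (hasStrictFDerivAt_norm_sq x).hasFDerivAt.const_mul (μ / 2)
  have htangent := (strongConvexOn_iff_convex.mp hf).add_fderiv_apply_sub_le hx hy (hd.sub hsq)
  have hnorm := norm_add_sq_real x (y - x)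
  rw [add_sub_cancel] at hnorm
  simp only [sub_apply, smul_apply, innerSL_apply_apply, smul_eq_mul, nsmul_eq_mul,
    Nat.cast_ofNat] at htangent
  rw [hnorm] at htangent
  linarith

variable {f : E → ℝ} {μ : ℝ}

/-- A differentiable strongly convex function on a finite-dimensional space is coercive. -/
theorem StrongConvexOn.tendsto_cocompact_atTop [ProperSpace E] (hf : StrongConvexOn univ μ f)
    (hμ : 0 < μ) {x : E} (hd : DifferentiableAt ℝ f x) : Tendsto f (cocompact E) atTop := by
  set C := ‖fderiv ℝ f x‖
  have hdist : Tendsto (fun y => ‖y - x‖) (cocompact E) atTop := by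
    simpa only [dist_eq_norm] using tendsto_dist_right_cocompact_atTop x
  have hlin : Tendsto (fun y => -C + μ / 2 * ‖y - x‖) (cocompact E) atTop :=
    tendsto_atTop_add_const_left _ _ (hdist.const_mul_atTop (half_pos hμ))
  refine tendsto_atTop_mono (fun y => ?_)
    (tendsto_atTop_add_const_left _ (f x) (hdist.atTop_mul_atTop₀ hlin))
  have hparab := hf.add_fderiv_apply_sub_add_le (mem_univ x) (mem_univ y) hd.hasFDerivAt
  have hop : -(C * ‖y - x‖) ≤ fderiv ℝ f x (y - x) :=
    (abs_le.mp ((fderiv ℝ f x).le_opNorm (y - x))).1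
  linarith

/-- The gradient of a strongly convex function is injective. -/
theorem StrongConvexOn.gradient_injective [CompleteSpace E] (hf : StrongConvexOn univ μ f)
    (hμ : 0 < μ) (hd : Differentiable ℝ f) : Function.Injective (gradient f) := by
  intro x y hxy
  have hxy' := hf.add_fderiv_apply_sub_add_le (mem_univ x) (mem_univ y) (hd x).hasFDerivAt
  have hyx' := hf.add_fderiv_apply_sub_add_le (mem_univ y) (mem_univ x) (hd y).hasFDerivAt
  rw [← inner_gradient_left, hxy, inner_sub_right] at hxy'
  rw [← inner_gradient_left, inner_sub_right, norm_sub_rev] at hyx'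
  have hle : μ * ‖y - x‖ ^ 2 ≤ 0 := by linarith
  have hzero : ‖y - x‖ ^ 2 = 0 :=
    le_antisymm (nonpos_of_mul_nonpos_right hle hμ) (sq_nonneg _)
  exact (sub_eq_zero.mp (norm_eq_zero.mp (pow_eq_zero_iff two_ne_zero |>.mp hzero))).symm

/-- Subtracting a linear functional preserves strong convexity. -/
theorem StrongConvexOn.sub_continuousLinearMap {s : Set E} (hf : StrongConvexOn s μ f)
    (l : E →L[ℝ] ℝ) : StrongConvexOn s μ (fun x => f x - l x) := by
  rw [strongConvexOn_iff_convex] at hf ⊢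
  refine (hf.sub (l.toLinearMap.concaveOn hf.1)).congr fun x _ => ?_
  simp only [Pi.sub_apply, ContinuousLinearMap.coe_coe]
  ring

/-- The gradient of a strongly convex function on a finite-dimensional space is surjective. -/
theorem StrongConvexOn.gradient_surjective [ProperSpace E] (hf : StrongConvexOn univ μ f)
    (hμ : 0 < μ) (hd : Differentiable ℝ f) : Function.Surjective (gradient f) := by
  intro u
  have hd' : Differentiable ℝ (fun x => f x - innerSL ℝ u x) := hd.sub (innerSL ℝ u).differentiable
  obtain ⟨x, hx⟩ := hd'.continuous.exists_forall_le
    ((hf.sub_continuousLinearMap (innerSL ℝ u)).tendsto_cocompact_atTop hμ (hd' 0))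
  have hcrit : fderiv ℝ f x - innerSL ℝ u = 0 :=
    IsLocalMin.hasFDerivAt_eq_zero (Eventually.of_forall hx)
      ((hd x).hasFDerivAt.sub (innerSL ℝ u).hasFDerivAt)
  refine ⟨x, HasGradientAt.gradient (hasGradientAt_iff_hasFDerivAt.mpr ?_)⟩
  have htoDual : InnerProductSpace.toDual ℝ E u = innerSL ℝ u := by
    ext v
    simp
  rw [htoDual, ← sub_eq_zero.mp hcrit]
  exact (hd x).hasFDerivAt

end StrongConvexity

/-- **Gradient of a strongly convex function is a bijection.** If `h : ℝⁿ → ℝ` is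
differentiable and `μ`-strongly convex, then `∇h` is a bijection of `ℝⁿ`; in particular,
for every `u` there is a unique `x` with `∇h(x) = u`, so the inverse map
`ψ = (∇h)⁻¹ = ∇h*` is well-defined on all of `ℝⁿ`. -/
theorem gradient_bijective_of_strongly_convex {n : ℕ}
    (h : EuclideanSpace ℝ (Fin n) → ℝ) (μ : ℝ) (hμ : 0 < μ)
    (hh : Differentiable ℝ h)
    (hsc : ConvexOn ℝ Set.univ (fun x => h x - μ / 2 * ‖x‖ ^ 2)) :
    Function.Bijective (gradient h) ∧
    ∀ u : EuclideanSpace ℝ (Fin n), ∃! x : EuclideanSpace ℝ (Fin n),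
      gradient h x = u := by
  have hf : StrongConvexOn univ μ h := strongConvexOn_iff_convex.mpr hsc
  have hbij : Function.Bijective (gradient h) :=
    ⟨hf.gradient_injective hμ hh, hf.gradient_surjective hμ hh⟩
  exact ⟨hbij, hbij.existsUnique⟩
end
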